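/- For all integers j ≥ 0, k ≥ 0 and all z ∈ ℂ, 2 · (L_{2k+1}(z))^j = ∑_{l=0}^{j} C(j,l) · (-1)^{l} · L_{(j-2l)(2k+1)}(z), where the Lucas polynomial with negative index is defined by L_{-n}(z) = (-1)^n · L_n(z). (Since 2k+1 is odd, (-1)^{l(2k+1)} = (-1)^l.) -/

import Mathlib

open Polynomial

/-- The Lucas polynomials: `L 0 = 2`, `L 1 = X`, `L (n+2) = X * L (n+1) + L n`. -/
noncomputable def lucasPoly : ℕ → Polynomial ℤ
  | 0 => 2
  | 1 => X
  | n + 2 => X * lucasPoly (n + 1) + lucasPoly n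

/-- The Lucas polynomials with integer index, extended by `L (-n) = (-1)^n L n`. -/
noncomputable def lucasPolyZ : ℤ → Polynomial ℤ
  | Int.ofNat n => lucasPoly n
  | Int.negSucc n => (-1) ^ (n + 1) * lucasPoly (n + 1)

lemma exists_lucas_roots (z : ℂ) : ∃ a b : ℂ, a + b = z ∧ a * b = -1 := by
  obtain ⟨s, hs⟩ := IsAlgClosed.exists_pow_nat_eq (z ^ 2 + 4) (n := 2) (by norm_num)
  refine ⟨(z + s) / 2, (z - s) / 2, by ring, ?_⟩
  linear_combination (-1 / 4) * hs

lemma aeval_lucasPoly (z a b : ℂ) (h1 : a + b = z) (h2 : a * b = -1) (n : ℕ) :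
    (aeval z (lucasPoly n) : ℂ) = a ^ n + b ^ n := by
  induction n using Nat.strong_induction_on with
  | _ n ih =>
    match n, ih with
    | 0, _ => simp only [lucasPoly, map_ofNat, pow_zero]; norm_num
    | 1, _ => simp [lucasPoly, h1]
    | n + 2, ih =>
      simp only [lucasPoly, map_add, map_mul, aeval_X, ih n (by omega), ih (n + 1) (by omega)]
      rw [← h1]
      linear_combination (a ^ n + b ^ n) * h2

lemma aeval_lucasPolyZ (z a b : ℂ) (h1 : a + b = z) (h2 : a * b = -1) (n : ℤ) :
    (aeval z (lucasPolyZ n) : ℂ) = a ^ n + b ^ n := by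
  cases n with
  | ofNat n => simpa [lucasPolyZ] using aeval_lucasPoly z a b h1 h2 n
  | negSucc n =>
    have ha : a ≠ 0 := by rintro rfl; simp at h2
    have hb : b ≠ 0 := by rintro rfl; simp at h2
    simp only [lucasPolyZ, map_mul, map_pow, map_neg, map_one, aeval_lucasPoly z a b h1 h2,
      zpow_negSucc]
    rw [← h2, mul_pow]
    have e : a ^ (n + 1) * b ^ (n + 1) * (a ^ (n + 1) * b ^ (n + 1)) = 1 := by
      rw [← mul_pow, h2, ← mul_pow]; norm_num
    have hA : a ^ (n + 1) ≠ 0 := pow_ne_zero _ ha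
    have hB : b ^ (n + 1) ≠ 0 := pow_ne_zero _ hb
    generalize a ^ (n + 1) = A at *
    generalize b ^ (n + 1) = B at *
    field_simp
    linear_combination (A + B) * e

lemma lucas_half (A B : ℂ) (h : A * B = -1) (j : ℕ) :
    (A + B) ^ j = ∑ l ∈ Finset.range (j + 1),
      (Nat.choose j l : ℂ) * (-1) ^ l * A ^ ((j : ℤ) - 2 * l) := by
  have hA : A ≠ 0 := by rintro rfl; simp at h
  rw [add_comm, add_pow]
  refine Finset.sum_congr rfl fun l hl => ?_
  have hl' : l ≤ j := by simpa [Nat.lt_succ_iff] using hl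
  have e : A ^ (j - l) = A ^ ((j : ℤ) - 2 * l) * A ^ l := by
    rw [← zpow_natCast, ← zpow_natCast, ← zpow_add₀ hA]
    congr 1
    push_cast [hl']
    ring
  rw [e, ← h, mul_pow]
  ring

/-- For all `j, k ≥ 0` and `z ∈ ℂ`,
`2 (L_{2k+1}(z))^j = ∑_{l=0}^{j} C(j,l) (-1)^l L_{(j-2l)(2k+1)}(z)`. -/
theorem lucas_power_expansion (j k : ℕ) (z : ℂ) :
    2 * (aeval z (lucasPoly (2 * k + 1)) : ℂ) ^ j =
      ∑ l ∈ Finset.range (j + 1),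
        (Nat.choose j l : ℂ) * (-1) ^ l *
          (aeval z (lucasPolyZ (((j : ℤ) - 2 * l) * (2 * k + 1))) : ℂ) := by
  obtain ⟨a, b, h1, h2⟩ := exists_lucas_roots z
  have h : a ^ (2 * k + 1) * b ^ (2 * k + 1) = -1 := by
    rw [← mul_pow, h2]; exact Odd.neg_one_pow ⟨k, rfl⟩
  have e1 := lucas_half _ _ h j
  have e2 := lucas_half _ _ ((mul_comm _ _).trans h) j
  rw [aeval_lucasPoly z a b h1 h2, two_mul]
  nth_rewrite 2 [add_comm]
  rw [e1, e2, ← Finset.sum_add_distrib]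
  refine Finset.sum_congr rfl fun l _ => ?_
  have key (x : ℂ) : (x ^ (2 * k + 1)) ^ ((j : ℤ) - 2 * l)
      = x ^ (((j : ℤ) - 2 * l) * (2 * k + 1)) := by
    rw [← zpow_natCast, ← zpow_mul, mul_comm]
    push_cast
    rfl
  rw [aeval_lucasPolyZ z a b h1 h2, key, key]
  ring
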